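/- Let (X₁,d₁,τ₁) and (X₂,d₂,τ₂) be two compact timed-metric spaces. Then d_{τ-GH}((X₁,d₁,τ₁),(X₂,d₂,τ₂)) = 0 if and only if there exists a bijection φ : X₁ → X₂ that is both distance preserving (d₂(φ(x),φ(x′)) = d₁(x,x′) for all x, x′) and time preserving (τ₂(φ(x)) = τ₁(x) for all x). -/

import Mathlib

/-- A bundled compact metric space. -/
structure CompMS : Type 1 where
  carrier : Type
  [metric : MetricSpace carrier]
  [compact : CompactSpace carrier]

attribute [instance] CompMS.metric CompMS.compact

instance : CoeSort CompMS Type := ⟨CompMS.carrier⟩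

/-- The set of values `d_H^{[0,τmax]×Z}(φ₁(X₁), φ₂(X₂))` over all compact metric spaces `Z`
and all time- and distance-preserving maps `φⱼ : Xⱼ → [0,τmax] × Z` into the max-product
space (the product metric is the `max`-metric, and `τ_prod` is the first coordinate), where
`τmax = max (sup τ₁) (sup τ₂)`. -/
def tauGHSet (X₁ X₂ : Type*) [MetricSpace X₁] [MetricSpace X₂]
    (τ₁ : X₁ → ℝ) (τ₂ : X₂ → ℝ) : Set ℝ :=
  { r | ∃ (Z : CompMS)
      (φ₁ : X₁ → Set.Icc (0:ℝ) (max (⨆ x, τ₁ x) (⨆ x, τ₂ x)) × Z)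
      (φ₂ : X₂ → Set.Icc (0:ℝ) (max (⨆ x, τ₁ x) (⨆ x, τ₂ x)) × Z),
      Isometry φ₁ ∧ Isometry φ₂ ∧
      (∀ x, ((φ₁ x).1 : ℝ) = τ₁ x) ∧ (∀ x, ((φ₂ x).1 : ℝ) = τ₂ x) ∧
      r = Metric.hausdorffDist (Set.range φ₁) (Set.range φ₂) }

/-- The timed-Gromov–Hausdorff distance. -/
noncomputable def tauGHDist (X₁ X₂ : Type*) [MetricSpace X₁] [MetricSpace X₂]
    (τ₁ : X₁ → ℝ) (τ₂ : X₂ → ℝ) : ℝ :=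
  sInf (tauGHSet X₁ X₂ τ₁ τ₂)

/-- The map `x ↦ (τ x, i x)` into a max-product space is isometric when `i` is isometric and
`τ` is 1-Lipschitz. -/
theorem isometry_codRestrict_prodMk {X Z : Type*} [PseudoMetricSpace X] [PseudoMetricSpace Z]
    {τ : X → ℝ} {s : Set ℝ} {i : X → Z} (hτ : LipschitzWith 1 τ) (hs : ∀ x, τ x ∈ s)
    (hi : Isometry i) : Isometry fun x => ((⟨τ x, hs x⟩ : s), i x) := by
  refine Isometry.of_dist_eq fun x y => ?_
  rw [Prod.dist_eq, Subtype.dist_eq, hi.dist_eq]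
  exact max_eq_right (by simpa using hτ.dist_le_mul x y)

theorem tauGHSet_nonneg {X₁ X₂ : Type*} [MetricSpace X₁] [MetricSpace X₂]
    {τ₁ : X₁ → ℝ} {τ₂ : X₂ → ℝ} {r : ℝ} (hr : r ∈ tauGHSet X₁ X₂ τ₁ τ₂) : 0 ≤ r := by
  obtain ⟨Z, φ₁, φ₂, -, -, -, -, rfl⟩ := hr
  exact Metric.hausdorffDist_nonneg

section TimedGH

variable {X₁ X₂ : Type} [MetricSpace X₁] [CompactSpace X₁] [MetricSpace X₂] [CompactSpace X₂]
  {τ₁ : X₁ → ℝ} {τ₂ : X₂ → ℝ}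

/-- Isometric embeddings into a common compact metric space give an element of `tauGHSet`. -/
theorem hausdorffDist_mem_tauGHSet (hτ₁0 : ∀ x, 0 ≤ τ₁ x) (hτ₂0 : ∀ x, 0 ≤ τ₂ x)
    (hτ₁ : LipschitzWith 1 τ₁) (hτ₂ : LipschitzWith 1 τ₂)
    (Z : Type) [MetricSpace Z] [CompactSpace Z] {i₁ : X₁ → Z} {i₂ : X₂ → Z}
    (hi₁ : Isometry i₁) (hi₂ : Isometry i₂) :
    ∃ (h₁ : ∀ x, τ₁ x ∈ Set.Icc (0 : ℝ) (max (⨆ x, τ₁ x) (⨆ x, τ₂ x)))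
      (h₂ : ∀ x, τ₂ x ∈ Set.Icc (0 : ℝ) (max (⨆ x, τ₁ x) (⨆ x, τ₂ x))),
      Metric.hausdorffDist (Set.range fun x => (Subtype.mk (τ₁ x) (h₁ x), i₁ x))
        (Set.range fun x => (Subtype.mk (τ₂ x) (h₂ x), i₂ x)) ∈ tauGHSet X₁ X₂ τ₁ τ₂ := by
  have h₁ : ∀ x, τ₁ x ∈ Set.Icc (0 : ℝ) (max (⨆ x, τ₁ x) (⨆ x, τ₂ x)) := fun x =>
    ⟨hτ₁0 x, (le_ciSup (isCompact_range hτ₁.continuous).bddAbove x).trans (le_max_left _ _)⟩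
  have h₂ : ∀ x, τ₂ x ∈ Set.Icc (0 : ℝ) (max (⨆ x, τ₁ x) (⨆ x, τ₂ x)) := fun x =>
    ⟨hτ₂0 x, (le_ciSup (isCompact_range hτ₂.continuous).bddAbove x).trans (le_max_right _ _)⟩
  exact ⟨h₁, h₂, ⟨Z⟩, _, _, isometry_codRestrict_prodMk hτ₁ h₁ hi₁,
    isometry_codRestrict_prodMk hτ₂ h₂ hi₂, fun _ => rfl, fun _ => rfl, rfl⟩

theorem tauGHSet_nonempty [Nonempty X₁] [Nonempty X₂]
    (hτ₁0 : ∀ x, 0 ≤ τ₁ x) (hτ₂0 : ∀ x, 0 ≤ τ₂ x)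
    (hτ₁ : LipschitzWith 1 τ₁) (hτ₂ : LipschitzWith 1 τ₂) :
    (tauGHSet X₁ X₂ τ₁ τ₂).Nonempty := by
  obtain ⟨a⟩ := ‹Nonempty X₁›
  obtain ⟨b⟩ := ‹Nonempty X₂›
  obtain ⟨_, _, h⟩ := hausdorffDist_mem_tauGHSet hτ₁0 hτ₂0 hτ₁ hτ₂ (X₁ × X₂)
    (i₁ := fun x => (x, b)) (i₂ := fun y => (a, y))
    (Isometry.of_dist_eq fun x y => by simp [Prod.dist_eq])
    (Isometry.of_dist_eq fun x y => by simp [Prod.dist_eq])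
  exact ⟨_, h⟩

/-- A value of `tauGHSet` below `ε` yields maps in both directions distorting distances and
times by a controlled amount, and almost inverse to each other. -/
theorem exists_almost_isometry_of_mem_tauGHSet [Nonempty X₁] [Nonempty X₂] {r ε : ℝ}
    (hr : r ∈ tauGHSet X₁ X₂ τ₁ τ₂) (hrε : r < ε) :
    ∃ (f : X₁ → X₂) (g : X₂ → X₁),
      (∀ x x', |dist (f x) (f x') - dist x x'| ≤ 2 * ε) ∧
      (∀ x, |τ₂ (f x) - τ₁ x| ≤ ε) ∧ (∀ x y, dist (f x) y ≤ dist x (g y) + 2 * ε) := by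
  obtain ⟨Z, φ₁, φ₂, hφ₁, hφ₂, ht₁, ht₂, rfl⟩ := hr
  have hfin := Metric.hausdorffEDist_ne_top_of_nonempty_of_bounded
    (Set.range_nonempty φ₁) (Set.range_nonempty φ₂)
    (isCompact_range hφ₁.continuous).isBounded (isCompact_range hφ₂.continuous).isBounded
  have hf : ∀ x, ∃ y, dist (φ₁ x) (φ₂ y) < ε := fun x => by
    simpa using Metric.exists_dist_lt_of_hausdorffDist_lt (Set.mem_range_self x) hrε hfin
  have hg : ∀ y, ∃ x, dist (φ₁ x) (φ₂ y) < ε := fun y => by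
    simpa using Metric.exists_dist_lt_of_hausdorffDist_lt' (Set.mem_range_self y) hrε hfin
  choose f hf using hf
  choose g hg using hg
  refine ⟨f, g, fun x x' => ?_, fun x => ?_, fun x y => ?_⟩
  · rw [← hφ₁.dist_eq, ← hφ₂.dist_eq, ← Real.dist_eq]
    refine (dist_dist_dist_le _ _ _ _).trans ?_
    rw [dist_comm (φ₂ (f x)), dist_comm (φ₂ (f x'))]
    linarith [hf x, hf x']
  · rw [← ht₁, ← ht₂, ← Real.dist_eq, dist_comm, ← Subtype.dist_eq]
    exact (le_max_left _ _).trans (hf x).le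
  · rw [← hφ₁.dist_eq, ← hφ₂.dist_eq]
    have h := dist_triangle4 (φ₂ (f x)) (φ₁ x) (φ₁ (g y)) (φ₂ y)
    rw [dist_comm (φ₂ (f x)) (φ₁ x)] at h
    linarith [hf x, hg y]

end TimedGH

open Filter Topology in
/-- Pointwise ultrafilter limits of almost isometries with almost inverses are isometric
bijections. -/
theorem exists_isometry_of_almost_isometries {X₁ X₂ : Type*} [MetricSpace X₁] [CompactSpace X₁]
    [MetricSpace X₂] [CompactSpace X₂] {τ₁ : X₁ → ℝ} {τ₂ : X₂ → ℝ} (hτ₂ : Continuous τ₂)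
    (H : ∀ ε : ℝ, 0 < ε → ∃ (f : X₁ → X₂) (g : X₂ → X₁),
      (∀ x x', |dist (f x) (f x') - dist x x'| ≤ 2 * ε) ∧
      (∀ x, |τ₂ (f x) - τ₁ x| ≤ ε) ∧ (∀ x y, dist (f x) y ≤ dist x (g y) + 2 * ε)) :
    ∃ φ : X₁ → X₂, Function.Bijective φ ∧
      (∀ x x', dist (φ x) (φ x') = dist x x') ∧ (∀ x, τ₂ (φ x) = τ₁ x) := by
  choose f g hfd hft hfg using fun n : ℕ => H (1 / ((n : ℝ) + 1)) Nat.one_div_pos_of_nat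
  let l : Ultrafilter ℕ := hyperfilter ℕ
  have hl : Tendsto (fun n : ℕ => 1 / ((n : ℝ) + 1)) l (𝓝 0) :=
    tendsto_one_div_add_atTop_nhds_zero_nat.mono_left Nat.hyperfilter_le_atTop
  have hl2 : Tendsto (fun n : ℕ => 2 * (1 / ((n : ℝ) + 1))) l (𝓝 0) := by
    simpa using hl.const_mul 2
  have hlimf : ∀ x, ∃ y, Tendsto (fun n => f n x) l (𝓝 y) := fun x =>
    ⟨_, (l.map fun n => f n x).le_nhds_lim⟩
  have hlimg : ∀ y, ∃ x, Tendsto (fun n => g n y) l (𝓝 x) := fun y =>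
    ⟨_, (l.map fun n => g n y).le_nhds_lim⟩
  choose φ hφ using hlimf
  choose ψ hψ using hlimg
  have hdist : ∀ x x', dist (φ x) (φ x') = dist x x' := fun x x' =>
    tendsto_nhds_unique ((hφ x).dist (hφ x')) <| tendsto_iff_dist_tendsto_zero.2 <|
      squeeze_zero (fun _ => dist_nonneg) (fun n => hfd n x x') hl2
  have hinv : ∀ y, φ (ψ y) = y := fun y => by
    refine tendsto_nhds_unique (hφ (ψ y)) <| tendsto_iff_dist_tendsto_zero.2 <|
      squeeze_zero (fun _ => dist_nonneg) (fun n => hfg n (ψ y) y) ?_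
    simpa using ((tendsto_const_nhds (x := ψ y)).dist (hψ y)).add hl2
  exact ⟨φ, ⟨(Isometry.of_dist_eq hdist).injective, fun y => ⟨ψ y, hinv y⟩⟩, hdist, fun x =>
    tendsto_nhds_unique ((hτ₂.tendsto _).comp (hφ x)) <| tendsto_iff_dist_tendsto_zero.2 <|
      squeeze_zero (fun _ => dist_nonneg) (fun n => hft n x) hl⟩

/-- The timed-Gromov–Hausdorff distance between two compact timed-metric spaces vanishes
iff there is a distance- and time-preserving bijection between them. -/
theorem tauGHDist_eq_zero_iff (X₁ X₂ : Type)
    [MetricSpace X₁] [CompactSpace X₁] [Nonempty X₁]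
    [MetricSpace X₂] [CompactSpace X₂] [Nonempty X₂]
    (τ₁ : X₁ → ℝ) (τ₂ : X₂ → ℝ) (hτ₁0 : ∀ x, 0 ≤ τ₁ x) (hτ₂0 : ∀ x, 0 ≤ τ₂ x)
    (hτ₁ : LipschitzWith 1 τ₁) (hτ₂ : LipschitzWith 1 τ₂) :
    tauGHDist X₁ X₂ τ₁ τ₂ = 0 ↔
      ∃ φ : X₁ → X₂, Function.Bijective φ ∧
        (∀ x x', dist (φ x) (φ x') = dist x x') ∧ (∀ x, τ₂ (φ x) = τ₁ x) := by
  constructor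
  · intro h
    refine exists_isometry_of_almost_isometries hτ₂.continuous fun ε hε => ?_
    obtain ⟨r, hr, hrε⟩ := exists_lt_of_csInf_lt (tauGHSet_nonempty hτ₁0 hτ₂0 hτ₁ hτ₂)
      (show sInf (tauGHSet X₁ X₂ τ₁ τ₂) < ε from h.trans_lt hε)
    exact exists_almost_isometry_of_mem_tauGHSet hr hrε
  · rintro ⟨φ, hbij, hdist, htime⟩
    obtain ⟨h₁, h₂, h⟩ := hausdorffDist_mem_tauGHSet hτ₁0 hτ₂0 hτ₁ hτ₂ X₂
      (Isometry.of_dist_eq hdist) isometry_id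
    have hrange : Set.range (fun x => (Subtype.mk (τ₁ x) (h₁ x), φ x)) =
        Set.range fun y => (Subtype.mk (τ₂ y) (h₂ y), id y) := by
      rw [← hbij.surjective.range_comp]
      simp [Function.comp_def, htime]
    rw [hrange, Metric.hausdorffDist_self_zero] at h
    exact le_antisymm (csInf_le ⟨0, fun _ => tauGHSet_nonneg⟩ h)
      (Real.sInf_nonneg fun _ => tauGHSet_nonneg)
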